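/- Let n ≥ 3 and let B ∈ 𝒰^n not be a parallelepiped. Suppose there are exactly two distinct indices i₁, i₂ ∈ {1,…,n} such that 𝟙 − e_{i₁} ∈ B and 𝟙 − e_{i₂} ∈ B, while 𝟙 − e_j ∉ B for every j ∉ {i₁,i₂}. Then there exists a set D of nonzero directions with D = −D and |D| ≤ 2^n − 2 that illuminates B. In particular 𝕀(B) ≤ 2^n − 2. -/

import Mathlib

open Set

/-- A convex body in `ℝ^n`: a compact convex set with nonempty interior. -/
def IsConvexBody {n : ℕ} (K : Set (Fin n → ℝ)) : Prop :=
  Convex ℝ K ∧ IsCompact K ∧ (interior K).Nonempty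

/-- `K` is 1-unconditional: closed under sign changes of the coordinates. -/
def Unconditional {n : ℕ} (K : Set (Fin n → ℝ)) : Prop :=
  ∀ x ∈ K, ∀ ε : Fin n → ℝ, (∀ i, ε i = 1 ∨ ε i = -1) → (fun i => ε i * x i) ∈ K

/-- The direction `d` illuminates the (boundary) point `x` of `K`. -/
def Illuminates {n : ℕ} (K : Set (Fin n → ℝ)) (d x : Fin n → ℝ) : Prop :=
  ∃ ε : ℝ, 0 < ε ∧ x + ε • d ∈ interior K

/-- The set of directions `D` illuminates every boundary point of `K`. -/
def IlluminatesSet {n : ℕ} (K : Set (Fin n → ℝ)) (D : Set (Fin n → ℝ)) : Prop :=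
  ∀ x ∈ frontier K, ∃ d ∈ D, Illuminates K d x

/-- The illumination number: smallest cardinality of a set of nonzero directions
illuminating `K`. -/
noncomputable def illumNumber {n : ℕ} (K : Set (Fin n → ℝ)) : ℕ :=
  sInf {m | ∃ D : Finset (Fin n → ℝ), D.card = m ∧ (∀ d ∈ D, d ≠ 0) ∧
    IlluminatesSet K ↑D}

/-- A parallelepiped: an affine image of the cube `[-1,1]^n`. -/
def IsParallelepiped {n : ℕ} (K : Set (Fin n → ℝ)) : Prop :=
  ∃ T : (Fin n → ℝ) ≃ᵃ[ℝ] (Fin n → ℝ),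
    K = T '' (Set.Icc (fun _ => (-1 : ℝ)) (fun _ => 1))

/-- The standard basis vector `e i`. -/
def stdB {n : ℕ} (i : Fin n) : Fin n → ℝ := Pi.single i 1

/-- The class `𝒰^n`: 1-unconditional convex bodies all of whose standard basis
vectors lie on the boundary. -/
def memU {n : ℕ} (K : Set (Fin n → ℝ)) : Prop :=
  IsConvexBody K ∧ Unconditional K ∧ ∀ i : Fin n, stdB i ∈ frontier K

/-- A 1-unconditional body is cubelike if all its extreme points have all
coordinates nonzero. -/
def Cubelike {n : ℕ} (K : Set (Fin n → ℝ)) : Prop :=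
  ∀ x ∈ Set.extremePoints ℝ K, ∀ i, x i ≠ 0

/-- The all-ones vector `𝟙`. -/
def allOnes {n : ℕ} : Fin n → ℝ := fun _ => 1

theorem clm_vec {n : ℕ} (f : (Fin n → ℝ) →L[ℝ] ℝ) :
    ∃ a : Fin n → ℝ, ∀ y, f y = ∑ i, a i * y i := by
  refine ⟨fun i => f (fun j => if i = j then 1 else 0), fun y => ?_⟩
  have := LinearMap.pi_apply_eq_sum_univ (f : (Fin n → ℝ) →ₗ[ℝ] ℝ) y
  simp only [ContinuousLinearMap.coe_coe, smul_eq_mul] at this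
  rw [this]
  exact Finset.sum_congr rfl fun i _ => mul_comm _ _

theorem reflect_abs {n : ℕ} {B : Set (Fin n → ℝ)} (hU : Unconditional B)
    (a y : Fin n → ℝ) (hy : y ∈ B) :
    ∃ z ∈ B, ∑ i, a i * z i = ∑ i, |a i| * |y i| := by
  refine ⟨_, hU y hy (fun i => if 0 ≤ a i * y i then 1 else -1) ?_, ?_⟩
  · intro i
    split_ifs <;> simp
  · refine Finset.sum_congr rfl fun i _ => ?_
    rw [← abs_mul]
    split_ifs with h
    · rw [abs_of_nonneg h]; ring
    · rw [abs_of_neg (not_le.mp h)]; ring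

/-- `a` is an outer normal of `B` at `x`, in unconditional form. -/
def Nrm {n : ℕ} (B : Set (Fin n → ℝ)) (a x : Fin n → ℝ) : Prop :=
  a ≠ 0 ∧ (∀ i, a i * x i = |a i| * |x i|) ∧
    ∀ y ∈ B, ∑ i, |a i| * |y i| ≤ ∑ i, |a i| * |x i|

theorem nrm_of {n : ℕ} {B : Set (Fin n → ℝ)} (hU : Unconditional B)
    (a x : Fin n → ℝ) (hx : x ∈ B) (ha : a ≠ 0)
    (h : ∀ y ∈ B, ∑ i, a i * y i ≤ ∑ i, a i * x i) : Nrm B a x := by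
  have key : ∀ y ∈ B, ∑ i, |a i| * |y i| ≤ ∑ i, a i * x i := by
    intro y hy
    obtain ⟨z, hz, he⟩ := reflect_abs hU a y hy
    rw [← he]; exact h z hz
  have hle : ∀ i ∈ Finset.univ, a i * x i ≤ |a i| * |x i| := by
    intro i _
    rw [← abs_mul]; exact le_abs_self _
  have heq : ∑ i, a i * x i = ∑ i, |a i| * |x i| :=
    le_antisymm (Finset.sum_le_sum hle) (key x hx)
  refine ⟨ha, fun i => (Finset.sum_eq_sum_iff_of_le hle).mp heq i (Finset.mem_univ i), ?_⟩
  intro y hy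
  rw [← heq]; exact key y hy

theorem exists_nrm_of_not_illum {n : ℕ} {B : Set (Fin n → ℝ)} (hB : memU B)
    (d x : Fin n → ℝ) (hx : x ∈ B) (hd : ¬ Illuminates B d x) :
    ∃ a, Nrm B a x ∧ 0 ≤ ∑ i, a i * d i := by
  obtain ⟨⟨hconv, hcomp, hint⟩, hU, _⟩ := hB
  have hray : Convex ℝ ((fun t : ℝ => x + t • d) '' Set.Ioi 0) := by
    rintro _ ⟨s, hs, rfl⟩ _ ⟨t, ht, rfl⟩ p q hp hq hpq
    refine ⟨p * s + q * t, ?_, ?_⟩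
    · exact (convex_Ioi (0:ℝ)) hs ht hp hq hpq
    · dsimp only
      have : x = p • x + q • x := by rw [← add_smul, hpq, one_smul]
      conv_lhs => rw [this]
      module
  have hdis : Disjoint (interior B) ((fun t : ℝ => x + t • d) '' Set.Ioi 0) := by
    rw [Set.disjoint_left]
    rintro _ hy ⟨t, ht, rfl⟩
    exact hd ⟨t, ht, hy⟩
  obtain ⟨f, u, h1, h2⟩ := geometric_hahn_banach_open hconv.interior isOpen_interior hray hdis
  have hcl : ∀ y ∈ B, f y ≤ u := by
    intro y hy
    have hy' : y ∈ closure (interior B) := by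
      rw [hconv.closure_interior_eq_closure_of_nonempty_interior hint]
      exact subset_closure hy
    exact closure_minimal (fun z hz => (h1 z hz).le : interior B ⊆ {z | f z ≤ u})
      (isClosed_le f.continuous continuous_const) hy'
  have hlin : ∀ t : ℝ, 0 < t → u ≤ f x + t * f d := by
    intro t ht
    have := h2 _ ⟨t, ht, rfl⟩
    simpa using this
  have hxu : f x ≤ u := hcl x hx
  have hfd : 0 ≤ f d := by
    have := hlin 1 one_pos
    linarith
  have hxu' : u ≤ f x := by
    by_contra hlt
    push Not at hlt
    have hp : 0 < (u - f x) / (2 * (f d + 1)) := by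
      apply div_pos <;> linarith
    have := hlin _ hp
    have h3 : (u - f x) / (2 * (f d + 1)) * f d ≤ (u - f x) / 2 := by
      rw [div_mul_eq_mul_div, div_le_div_iff₀ (by linarith) (by norm_num)]
      nlinarith
    linarith
  obtain ⟨a, ha⟩ := clm_vec f
  refine ⟨a, nrm_of hU a x hx ?_ ?_, by rw [← ha]; exact hfd⟩
  · rintro rfl
    obtain ⟨z, hz⟩ := hint
    have e1 := h1 z hz
    rw [ha z] at e1
    rw [ha x] at hxu
    rw [ha x] at hxu'
    simp at e1 hxu hxu'
    linarith
  · intro y hy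
    rw [← ha, ← ha]
    exact (hcl y hy).trans hxu'

theorem std_mem {n : ℕ} {B : Set (Fin n → ℝ)} (hB : memU B) (i : Fin n) : stdB i ∈ B :=
  hB.1.2.1.isClosed.frontier_subset (hB.2.2 i)

theorem sum_std {n : ℕ} (a : Fin n → ℝ) (i : Fin n) :
    ∑ j, |a j| * |(stdB i : Fin n → ℝ) j| = |a i| := by
  rw [Finset.sum_eq_single i]
  · simp [stdB]
  · intro j _ hj
    simp [stdB, hj]
  · simp

theorem abs_le_one_of_mem {n : ℕ} {B : Set (Fin n → ℝ)} (hB : memU B) (x : Fin n → ℝ)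
    (hx : x ∈ B) (i : Fin n) : |x i| ≤ 1 := by
  have hni : ¬ Illuminates B 0 (stdB i) := by
    rintro ⟨t, _, ht⟩
    simp only [smul_zero, add_zero] at ht
    exact (hB.2.2 i).2 ht
  obtain ⟨a, ⟨ha, _, h2⟩, -⟩ := exists_nrm_of_not_illum hB 0 (stdB i) (std_mem hB i) hni
  rw [sum_std] at h2
  have hpos : 0 < |a i| := by
    rcases (abs_nonneg (a i)).lt_or_eq with h | h
    · exact h
    · exfalso
      apply ha
      funext j
      have := h2 _ (std_mem hB j)
      rw [sum_std, ← h] at this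
      exact abs_nonpos_iff.mp this
  have h3 := h2 x hx
  have h4 : |a i| * |x i| ≤ ∑ j, |a j| * |x j| :=
    Finset.single_le_sum (f := fun j => |a j| * |x j|) (fun j _ => by positivity)
      (Finset.mem_univ i)
  nlinarith

theorem sum_split {n : ℕ} (i₁ i₂ : Fin n) (hne : i₁ ≠ i₂) (f : Fin n → ℝ) :
    ∑ i, f i = f i₁ + f i₂ + ∑ i ∈ (Finset.univ.erase i₁).erase i₂, f i := by
  rw [← Finset.add_sum_erase Finset.univ f (Finset.mem_univ i₁),
    ← Finset.add_sum_erase (Finset.univ.erase i₁) f (a := i₂) (by simp [hne.symm])]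
  ring

theorem sum_ones {n : ℕ} (a : Fin n → ℝ) (i : Fin n) :
    ∑ j, |a j| * |(allOnes - stdB i : Fin n → ℝ) j| = ∑ j, |a j| - |a i| := by
  have : ∀ j, |a j| * |(allOnes - stdB i : Fin n → ℝ) j| =
      |a j| - |a j| * |(stdB i : Fin n → ℝ) j| := by
    intro j
    by_cases h : j = i
    · subst h; simp [allOnes, stdB]
    · simp [allOnes, stdB, h]
  simp_rw [this, Finset.sum_sub_distrib, sum_std]

/-- The basic slack inequality. -/
theorem slack {n : ℕ} {B : Set (Fin n → ℝ)} (a x : Fin n → ℝ) (i : Fin n)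
    (h1 : allOnes - stdB i ∈ B) (ha : Nrm B a x) :
    ∑ j, |a j| * (1 - |x j|) ≤ |a i| := by
  have := ha.2.2 _ h1
  rw [sum_ones] at this
  simp_rw [mul_sub, mul_one, Finset.sum_sub_distrib]
  linarith

theorem diamond_par {n : ℕ} (i₁ i₂ : Fin n) (hne : i₁ ≠ i₂) :
    IsParallelepiped {y : Fin n → ℝ | |y i₁| + |y i₂| ≤ 1 ∧ ∀ j, |y j| ≤ 1} := by
  let L : (Fin n → ℝ) ≃ₗ[ℝ] (Fin n → ℝ) :=
    { toFun := fun z j => if j = i₁ then (z i₁ + z i₂) / 2 else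
        if j = i₂ then (z i₁ - z i₂) / 2 else z j
      invFun := fun z j => if j = i₁ then z i₁ + z i₂ else
        if j = i₂ then z i₁ - z i₂ else z j
      map_add' := by
        intro x y; funext j; simp only [Pi.add_apply]; split_ifs <;> ring
      map_smul' := by
        intro c y; funext j
        simp only [Pi.smul_apply, smul_eq_mul, RingHom.id_apply]; split_ifs <;> ring
      left_inv := by
        intro z; funext j
        simp only [if_true, hne.symm, if_false]
        split_ifs with h h'
        · subst h; ring
        · subst h'; ring
        · rfl
      right_inv := by
        intro z; funext j
        simp only [if_true, hne.symm, if_false]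
        split_ifs with h h'
        · subst h; ring
        · subst h'; ring
        · rfl }
  refine ⟨L.toAffineEquiv, ?_⟩
  have hL : ∀ z j, L.toAffineEquiv z j = if j = i₁ then (z i₁ + z i₂) / 2 else
        if j = i₂ then (z i₁ - z i₂) / 2 else z j := fun z j => rfl
  ext y
  constructor
  · rintro ⟨h1, h2⟩
    refine ⟨L.symm y, ?_, L.apply_symm_apply y⟩
    have hs : ∀ j, L.symm y j = if j = i₁ then y i₁ + y i₂ else
        if j = i₂ then y i₁ - y i₂ else y j := fun j => rfl
    have e1 := le_abs_self (y i₁)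
    have e2 := le_abs_self (y i₂)
    have e3 := neg_abs_le (y i₁)
    have e4 := neg_abs_le (y i₂)
    constructor <;> intro j <;> rw [hs] <;> dsimp only <;> have h3 := abs_le.mp (h2 j) <;>
      split_ifs <;> linarith
  · rintro ⟨z, ⟨hz1, hz2⟩, rfl⟩
    have a1 := hz1 i₁
    have a2 := hz1 i₂
    have b1 := hz2 i₁
    have b2 := hz2 i₂
    dsimp only at a1 a2 b1 b2
    refine ⟨?_, fun j => ?_⟩
    · rw [hL, hL, if_pos rfl, if_neg hne.symm, if_pos rfl]
      rcases abs_cases ((z i₁ + z i₂) / 2) with ⟨h, _⟩ | ⟨h, _⟩ <;>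
      rcases abs_cases ((z i₁ - z i₂) / 2) with ⟨h', _⟩ | ⟨h', _⟩ <;> linarith
    · rw [hL]
      have c1 := hz1 j
      have c2 := hz2 j
      dsimp only at c1 c2
      rw [abs_le]
      split_ifs <;> constructor <;> linarith

theorem diamond_sub {n : ℕ} {B : Set (Fin n → ℝ)} (hB : memU B) (i₁ i₂ : Fin n)
    (hne : i₁ ≠ i₂) (h1 : allOnes - stdB i₁ ∈ B) (h2 : allOnes - stdB i₂ ∈ B)
    (y : Fin n → ℝ) (hy : |y i₁| + |y i₂| ≤ 1) (hy' : ∀ j, |y j| ≤ 1) : y ∈ B := by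
  by_contra hyB
  obtain ⟨f, u, hf1, hf2⟩ := geometric_hahn_banach_closed_point hB.1.1 hB.1.2.1.isClosed hyB
  obtain ⟨a, ha⟩ := clm_vec f
  have key : ∀ i, allOnes - stdB i ∈ B → ∑ j, |a j| - |a i| < ∑ j, |a j| * |y j| := by
    intro i hi
    obtain ⟨z, hz, he⟩ := reflect_abs hB.2.1 a _ hi
    rw [sum_ones] at he
    have := hf1 z hz
    rw [ha, he] at this
    rw [ha] at hf2
    have : ∑ j, a j * y j ≤ ∑ j, |a j| * |y j| :=
      Finset.sum_le_sum fun j _ => by rw [← abs_mul]; exact le_abs_self _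
    linarith
  have k1 := key _ h1
  have k2 := key _ h2
  rw [sum_split i₁ i₂ hne (fun j => |a j|), sum_split i₁ i₂ hne (fun j => |a j| * |y j|)] at k1 k2
  have hT : ∑ j ∈ (Finset.univ.erase i₁).erase i₂, |a j| * |y j| ≤
      ∑ j ∈ (Finset.univ.erase i₁).erase i₂, |a j| :=
    Finset.sum_le_sum fun j _ => mul_le_of_le_one_right (abs_nonneg _) (hy' j)
  have p1 := abs_nonneg (y i₁)
  have p2 := abs_nonneg (y i₂)
  have q1 := abs_nonneg (a i₁)
  have q2 := abs_nonneg (a i₂)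
  rcases le_total (|a i₁|) (|a i₂|) with h | h
  · have := mul_le_mul_of_nonneg_right h p1
    nlinarith
  · have := mul_le_mul_of_nonneg_right h p2
    nlinarith

theorem no_diag {n : ℕ} {B : Set (Fin n → ℝ)} (hB : memU B)
    (hpar : ¬ IsParallelepiped B) (i₁ i₂ : Fin n)
    (hne : i₁ ≠ i₂) (h1 : allOnes - stdB i₁ ∈ B) (h2 : allOnes - stdB i₂ ∈ B)
    (a x : Fin n → ℝ) (hx : x ∈ B) (ha : Nrm B a x) (hx1 : x i₁ = 0)
    (he : |a i₁| = |a i₂|) (hz : ∀ j, j ≠ i₁ → j ≠ i₂ → a j = 0) : False := by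
  apply hpar
  have hs : ∀ y : Fin n → ℝ, ∑ j, |a j| * |y j| = |a i₁| * (|y i₁| + |y i₂|) := by
    intro y
    rw [sum_split i₁ i₂ hne, Finset.sum_eq_zero, ← he]
    · ring
    · intro j hj
      simp only [Finset.mem_erase, Finset.mem_univ, and_true] at hj
      rw [hz j hj.2 hj.1]; simp
  have hpos : 0 < |a i₁| := by
    rcases (abs_nonneg (a i₁)).lt_or_eq with h | h
    · exact h
    · exfalso
      apply ha.1
      funext j
      by_cases hj1 : j = i₁
      · subst hj1; exact abs_eq_zero.mp h.symm
      by_cases hj2 : j = i₂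
      · subst hj2; exact abs_eq_zero.mp (he ▸ h.symm)
      exact hz j hj1 hj2
  have : B = {y : Fin n → ℝ | |y i₁| + |y i₂| ≤ 1 ∧ ∀ j, |y j| ≤ 1} := by
    ext y
    constructor
    · intro hy
      refine ⟨?_, abs_le_one_of_mem hB y hy⟩
      have h3 := ha.2.2 y hy
      rw [hs, hs, hx1] at h3
      have h4 := le_of_mul_le_mul_left h3 hpos
      have := abs_le_one_of_mem hB x hx i₂
      simp only [abs_zero, zero_add] at h4
      linarith
    · rintro ⟨e1, e2⟩
      exact diamond_sub hB i₁ i₂ hne h1 h2 y e1 e2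
  rw [this]
  exact diamond_par i₁ i₂ hne

/-- Setup: consequence of normals opposing a direction. -/
theorem rest_facts {n : ℕ} {B : Set (Fin n → ℝ)} (hB : memU B) (i₁ i₂ : Fin n)
    (a x d : Fin n → ℝ) (hx : x ∈ B) (ha : Nrm B a x)
    (hd0 : ∀ i, d i ≠ 0) (hd1 : ∀ i, |d i| ≤ 1) (hdx : ∀ i, x i ≠ 0 → d i * x i < 0) :
    ∃ P Q : ℝ, 0 ≤ P ∧ 0 ≤ Q ∧
      P = ∑ i ∈ (Finset.univ.erase i₁).erase i₂, |a i| * (1 - |x i|) ∧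
      ∑ i ∈ (Finset.univ.erase i₁).erase i₂, a i * d i ≤ P - Q ∧
      (P ≤ 0 → Q ≤ 0 → ∀ j, j ≠ i₁ → j ≠ i₂ → a j = 0) ∧
      (∀ i, x i ≠ 0 → a i * d i = -(|a i| * |d i|)) ∧
      (∀ i, a i * d i ≤ |a i| * |d i|) := by
  have hnz : ∀ i, x i ≠ 0 → a i * d i = -(|a i| * |d i|) := by
    intro i hi
    have e1 := ha.2.1 i
    have e2 := hdx i hi
    rw [← abs_mul] at e1 ⊢
    have e3 : 0 ≤ a i * x i := by rw [e1]; exact abs_nonneg _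
    have : a i * d i ≤ 0 := by
      by_contra hc
      push Not at hc
      have h4 : 0 < x i ^ 2 := by positivity
      have h5 : (a i * d i) * x i ^ 2 = (a i * x i) * (d i * x i) := by ring
      nlinarith [mul_pos hc h4]
    rw [abs_of_nonpos this]; ring
  have hgen : ∀ i, a i * d i ≤ |a i| * |d i| := fun i => by
    rw [← abs_mul]; exact le_abs_self _
  have hX := abs_le_one_of_mem hB x hx
  have hp : ∀ i, 0 ≤ |a i| * (1 - |x i|) := fun i =>
    mul_nonneg (abs_nonneg _) (by linarith [hX i])
  have hq : ∀ i, 0 ≤ (if x i = 0 then 0 else |a i| * |d i|) := fun i => by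
    split_ifs <;> positivity
  refine ⟨∑ i ∈ (Finset.univ.erase i₁).erase i₂, |a i| * (1 - |x i|),
    ∑ i ∈ (Finset.univ.erase i₁).erase i₂, (if x i = 0 then 0 else |a i| * |d i|),
    Finset.sum_nonneg fun i _ => hp i, Finset.sum_nonneg fun i _ => hq i, rfl, ?_, ?_, hnz, hgen⟩
  · rw [← Finset.sum_sub_distrib]
    refine Finset.sum_le_sum fun i _ => ?_
    split_ifs with h
    · rw [h, abs_zero]
      have := mul_le_mul_of_nonneg_left (hd1 i) (abs_nonneg (a i))
      linarith [hgen i]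
    · rw [hnz i h]; linarith [hp i]
  · intro hP hQ j hj1 hj2
    have hP' := (Finset.sum_eq_zero_iff_of_nonneg (fun i _ => hp i)).mp
      (le_antisymm hP (Finset.sum_nonneg fun i _ => hp i)) j (by simp [hj1, hj2])
    have hQ' := (Finset.sum_eq_zero_iff_of_nonneg (fun i _ => hq i)).mp
      (le_antisymm hQ (Finset.sum_nonneg fun i _ => hq i)) j (by simp [hj1, hj2])
    by_cases h : x j = 0
    · simpa [h] using hP'
    · simpa [h, hd0 j] using hQ'

theorem illum_both {n : ℕ} {B : Set (Fin n → ℝ)} (hB : memU B) (i₁ i₂ : Fin n)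
    (hne : i₁ ≠ i₂) (h1 : allOnes - stdB i₁ ∈ B) (h2 : allOnes - stdB i₂ ∈ B)
    (x d : Fin n → ℝ) (hx : x ∈ B)
    (hd0 : ∀ i, d i ≠ 0) (hd1 : ∀ i, |d i| ≤ 1) (hdx : ∀ i, x i ≠ 0 → d i * x i < 0)
    (hx1 : x i₁ ≠ 0) (hx2 : x i₂ ≠ 0) (hm : |d i₁| = 1) :
    Illuminates B d x := by
  by_contra hni
  obtain ⟨a, ha, had⟩ := exists_nrm_of_not_illum hB d x hx hni
  obtain ⟨P, Q, hP, hQ, hPe, hsum, hz, hnz, -⟩ := rest_facts hB i₁ i₂ a x d hx ha hd0 hd1 hdx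
  have s2 := slack a x i₂ h2 ha
  rw [sum_split i₁ i₂ hne] at s2 had
  rw [← hPe] at s2
  rw [hnz i₁ hx1, hnz i₂ hx2, hm] at had
  have A1 := abs_nonneg (a i₁)
  have A2 := abs_nonneg (a i₂)
  have s1 := slack a x i₁ h1 ha
  rw [sum_split i₁ i₂ hne, ← hPe] at s1
  have t1 : 0 ≤ |a i₁| * (1 - |x i₁|) :=
    mul_nonneg A1 (by linarith [abs_le_one_of_mem hB x hx i₁])
  have t2 : 0 ≤ |a i₂| * (1 - |x i₂|) :=
    mul_nonneg A2 (by linarith [abs_le_one_of_mem hB x hx i₂])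
  have hdp : 0 < |d i₂| := abs_pos.mpr (hd0 i₂)
  have t3 : 0 ≤ |a i₂| * |d i₂| := by positivity
  have t4 : |a i₂| * |d i₂| = 0 := by linarith
  have t5 : |a i₂| = 0 := by
    rcases mul_eq_zero.mp t4 with h | h
    · exact h
    · exact absurd h hdp.ne'
  have t6 : |a i₁| = 0 := by linarith
  have hr := hz (by linarith) (by linarith)
  apply ha.1
  funext j
  by_cases hj1 : j = i₁
  · subst hj1; exact abs_eq_zero.mp t6
  by_cases hj2 : j = i₂
  · subst hj2; exact abs_eq_zero.mp t5
  exact hr j hj1 hj2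

theorem illum_one {n : ℕ} {B : Set (Fin n → ℝ)} (hB : memU B)
    (hpar : ¬ IsParallelepiped B) (i₁ i₂ : Fin n)
    (hne : i₁ ≠ i₂) (h1 : allOnes - stdB i₁ ∈ B) (h2 : allOnes - stdB i₂ ∈ B)
    (x d : Fin n → ℝ) (hx : x ∈ B)
    (hd0 : ∀ i, d i ≠ 0) (hd1 : ∀ i, |d i| ≤ 1) (hdx : ∀ i, x i ≠ 0 → d i * x i < 0)
    (hx1 : x i₁ = 0) (hx2 : x i₂ ≠ 0) (hm : |d i₁| ≤ |d i₂|) :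
    Illuminates B d x := by
  by_contra hni
  obtain ⟨a, ha, had⟩ := exists_nrm_of_not_illum hB d x hx hni
  obtain ⟨P, Q, hP, hQ, hPe, hsum, hz, hnz, hgen⟩ :=
    rest_facts hB i₁ i₂ a x d hx ha hd0 hd1 hdx
  have s2 := slack a x i₂ h2 ha
  rw [sum_split i₁ i₂ hne] at s2 had
  rw [← hPe, hx1, abs_zero] at s2
  rw [hnz i₂ hx2] at had
  have A1 := abs_nonneg (a i₁)
  have A2 := abs_nonneg (a i₂)
  have s1 := slack a x i₁ h1 ha
  rw [sum_split i₁ i₂ hne, ← hPe, hx1, abs_zero] at s1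
  have t2 : 0 ≤ |a i₂| * (1 - |x i₂|) :=
    mul_nonneg A2 (by linarith [abs_le_one_of_mem hB x hx i₂])
  have hdp : 0 < |d i₁| := abs_pos.mpr (hd0 i₁)
  have hg := hgen i₁
  have u1 : |a i₁| * |d i₁| ≤ |a i₂| * |d i₁| :=
    mul_le_mul_of_nonneg_right (by linarith) hdp.le
  have u2 : |a i₂| * |d i₁| ≤ |a i₂| * |d i₂| := mul_le_mul_of_nonneg_left hm A2
  have u3 : |a i₂| ≤ |a i₁| := le_of_mul_le_mul_right (by linarith) hdp
  exact no_diag hB hpar i₁ i₂ hne h1 h2 a x hx ha hx1 (by linarith)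
    (hz (by linarith) (by linarith))

theorem illum_none {n : ℕ} {B : Set (Fin n → ℝ)} (hB : memU B) (i₁ i₂ : Fin n)
    (hne : i₁ ≠ i₂) (h1 : allOnes - stdB i₁ ∈ B) (h2 : allOnes - stdB i₂ ∈ B)
    (x d : Fin n → ℝ) (hx : x ∈ B)
    (hd0 : ∀ i, d i ≠ 0) (hd1 : ∀ i, |d i| ≤ 1) (hdx : ∀ i, x i ≠ 0 → d i * x i < 0)
    (hx1 : x i₁ = 0) (hx2 : x i₂ = 0) :
    Illuminates B d x := by
  by_contra hni
  obtain ⟨a, ha, had⟩ := exists_nrm_of_not_illum hB d x hx hni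
  obtain ⟨P, Q, hP, hQ, hPe, hsum, hz, hnz, hgen⟩ :=
    rest_facts hB i₁ i₂ a x d hx ha hd0 hd1 hdx
  have s2 := slack a x i₂ h2 ha
  have s1 := slack a x i₁ h1 ha
  rw [sum_split i₁ i₂ hne] at s1 s2 had
  rw [← hPe, hx1, hx2, abs_zero] at s1 s2
  have A1 := abs_nonneg (a i₁)
  have A2 := abs_nonneg (a i₂)
  have t1 : a i₁ = 0 := abs_eq_zero.mp (by linarith)
  have t2 : a i₂ = 0 := abs_eq_zero.mp (by linarith)
  rw [t1, t2] at had
  have hr := hz (by linarith) (by linarith)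
  apply ha.1
  funext j
  by_cases hj1 : j = i₁
  · subst hj1; exact t1
  by_cases hj2 : j = i₂
  · subst hj2; exact t2
  exact hr j hj1 hj2

/-- Sign of a Boolean. -/
def sg (b : Bool) : ℝ := if b then 1 else -1

/-- Modified sign vector: a lone sign is scaled by `η`. -/
noncomputable def gdir {n : ℕ} (η : ℝ) (σ : Fin n → Bool) : Fin n → ℝ := fun i =>
  (if ∀ j, j ≠ i → σ j ≠ σ i then η else 1) * sg (σ i)

theorem sg_abs (b : Bool) : |sg b| = 1 := by cases b <;> simp [sg]

theorem gdir_ne {n : ℕ} {η : ℝ} (hη : 0 < η) (σ : Fin n → Bool) (i : Fin n) :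
    gdir η σ i ≠ 0 := by
  unfold gdir sg
  split_ifs <;> simp [hη.ne']

theorem gdir_abs_le {n : ℕ} {η : ℝ} (hη : 0 < η) (hη1 : η ≤ 1) (σ : Fin n → Bool) (i : Fin n) :
    |gdir η σ i| ≤ 1 := by
  unfold gdir
  rw [abs_mul, sg_abs]
  split_ifs
  · rw [abs_of_pos hη]; linarith
  · simp

theorem gdir_abs_eq {n : ℕ} {η : ℝ} (σ : Fin n → Bool) (i j : Fin n) (hij : j ≠ i)
    (h : σ j = σ i) : |gdir η σ i| = 1 := by
  unfold gdir
  rw [abs_mul, sg_abs, if_neg]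
  · simp
  · intro hc; exact hc j hij h

theorem gdir_neg {n : ℕ} (η : ℝ) (σ : Fin n → Bool) :
    gdir η (fun i => !σ i) = - gdir η σ := by
  funext i
  unfold gdir
  have hiff : (∀ j, j ≠ i → (!σ j) ≠ (!σ i)) ↔ (∀ j, j ≠ i → σ j ≠ σ i) :=
    forall_congr' fun j => imp_congr_right fun _ => by
      cases σ j <;> cases σ i <;> simp
  have : sg (!σ i) = - sg (σ i) := by cases σ i <;> simp [sg]
  simp only [Pi.neg_apply, this, if_congr hiff rfl rfl]
  ring

theorem gdir_opp {n : ℕ} {η : ℝ} (hη : 0 < η) (σ : Fin n → Bool) (x : Fin n → ℝ) (i : Fin n)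
    (hx : x i ≠ 0) (h : σ i = decide (x i < 0)) : gdir η σ i * x i < 0 := by
  have hc : 0 < (if ∀ j, j ≠ i → σ j ≠ σ i then η else 1) := by
    split_ifs <;> linarith
  unfold gdir
  rw [mul_assoc]
  apply mul_neg_of_pos_of_neg hc
  rw [h]
  rcases lt_or_gt_of_ne hx with hl | hl
  · simp [sg, hl]
  · simp [sg, hl, not_lt.mpr hl.le]

theorem third {n : ℕ} (hn : 3 ≤ n) (i j : Fin n) : ∃ k : Fin n, k ≠ i ∧ k ≠ j := by
  by_contra! h
  have : (Finset.univ : Finset (Fin n)) ⊆ {i, j} := by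
    intro k _
    simp only [Finset.mem_insert, Finset.mem_singleton]
    by_cases hk : k = i
    · exact Or.inl hk
    · exact Or.inr (h k hk)
  have h1 := Finset.card_le_card this
  have h2 := Finset.card_le_two (a := i) (b := j)
  simp only [Finset.card_univ, Fintype.card_fin] at h1
  omega

theorem choose_one {n : ℕ} (hn : 3 ≤ n) {B : Set (Fin n → ℝ)} (hB : memU B)
    (hpar : ¬ IsParallelepiped B) (i₁ i₂ : Fin n)
    (hne : i₁ ≠ i₂) (h1 : allOnes - stdB i₁ ∈ B) (h2 : allOnes - stdB i₂ ∈ B)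
    (η : ℝ) (hη : 0 < η) (hη1 : η ≤ 1)
    (x : Fin n → ℝ) (hx : x ∈ B) (hx1 : x i₁ = 0) (hx2 : x i₂ ≠ 0) :
    ∃ σ : Fin n → Bool, (∃ i j, σ i ≠ σ j) ∧ Illuminates B (gdir η σ) x := by
  suffices ∃ σ : Fin n → Bool, (∃ i j, σ i ≠ σ j) ∧ (∃ j, j ≠ i₂ ∧ σ j = σ i₂) ∧
      ∀ i, x i ≠ 0 → σ i = decide (x i < 0) by
    obtain ⟨σ, hc, ⟨j, hj, hj'⟩, ho⟩ := this
    refine ⟨σ, hc, illum_one hB hpar i₁ i₂ hne h1 h2 x _ hx (gdir_ne hη σ)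
      (gdir_abs_le hη hη1 σ) (fun i hi => gdir_opp hη σ x i hi (ho i hi)) hx1 hx2 ?_⟩
    rw [gdir_abs_eq σ i₂ j hj hj']
    exact gdir_abs_le hη hη1 σ i₁
  by_cases hmix : ∃ k, x k ≠ 0 ∧ decide (x k < 0) ≠ decide (x i₂ < 0)
  · obtain ⟨k, hk, hk'⟩ := hmix
    refine ⟨fun i => if x i = 0 then decide (x i₂ < 0) else decide (x i < 0),
      ⟨k, i₂, by simpa [hk, hx2] using hk'⟩, ⟨i₁, hne, by simp [hx1, hx2]⟩, fun i hi => by simp [hi]⟩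
  · push Not at hmix
    obtain ⟨k, hk1, hk2⟩ := third hn i₁ i₂
    refine ⟨fun i => if i = i₁ then !decide (x i₂ < 0) else decide (x i₂ < 0),
      ⟨i₁, i₂, by simp [hne.symm]⟩, ⟨k, hk2, by simp [hk1, hne.symm]⟩, fun i hi => ?_⟩
    have : i ≠ i₁ := by rintro rfl; exact hi hx1
    dsimp only
    rw [if_neg this, hmix i hi]

theorem ones_not_mem {n : ℕ} {B : Set (Fin n → ℝ)} (hB : memU B) (k : Fin n)
    (hk : allOnes - stdB k ∉ B) : (allOnes : Fin n → ℝ) ∉ B := by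
  intro h
  apply hk
  have h' := hB.2.1 _ h (fun i => if i = k then -1 else 1) (by intro i; split_ifs <;> simp)
  have := hB.1.1 h h' (by norm_num : (0:ℝ) ≤ 1/2) (by norm_num : (0:ℝ) ≤ 1/2) (by norm_num)
  convert this using 1
  funext i
  by_cases hi : i = k
  · subst hi; simp [allOnes, stdB]
  · simp [allOnes, stdB, hi]; norm_num

theorem choose_const {n : ℕ} (hn : 3 ≤ n) {B : Set (Fin n → ℝ)} (hB : memU B)
    (η : ℝ) (hη : 0 < η) (hη1 : η ≤ 1)
    (hfar : ∀ y ∈ B, ∃ i, y i < 1 - η)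
    (x : Fin n → ℝ) (hx : x ∈ B) (hx0 : ∀ i, x i ≠ 0) (b : Bool)
    (hb : ∀ i, decide (x i < 0) = b) :
    ∃ σ : Fin n → Bool, (∃ i j, σ i ≠ σ j) ∧ Illuminates B (gdir η σ) x := by
  have habs : (fun i => |x i|) ∈ B := by
    convert hB.2.1 x hx (fun i => if 0 ≤ x i then 1 else -1)
      (by intro i; split_ifs <;> simp) using 1
    funext i
    split_ifs with h
    · rw [abs_of_nonneg h]; ring
    · rw [abs_of_neg (not_le.mp h)]; ring
  obtain ⟨i, hi⟩ := hfar _ habs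
  obtain ⟨k, hk, -⟩ := third hn i i
  refine ⟨fun j => if j = i then !b else b, ⟨i, k, by simp [hk]⟩, ?_⟩
  by_contra hni
  obtain ⟨a, ha, had⟩ := exists_nrm_of_not_illum hB _ x hx hni
  have hA : ∀ j, a j * sg b = - |a j| := by
    intro j
    have e1 := ha.2.1 j
    rw [← abs_mul] at e1
    have e2 : 0 ≤ a j * x j := by rw [e1]; exact abs_nonneg _
    have e3 := hb j
    rcases lt_or_gt_of_ne (hx0 j) with hl | hl
    · have : b = true := by rw [← e3]; simp [hl]
      subst this
      have : a j ≤ 0 := by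
        by_contra hc
        push Not at hc
        nlinarith [mul_neg_of_pos_of_neg hc hl]
      rw [abs_of_nonpos this]; simp [sg]
    · have : b = false := by rw [← e3]; simp [hl.le]
      subst this
      have : 0 ≤ a j := by
        by_contra hc
        push Not at hc
        nlinarith [mul_neg_of_neg_of_pos hc hl]
      rw [abs_of_nonneg this]; simp [sg]
  have hgi : gdir η (fun j => if j = i then !b else b) i = - (η * sg b) := by
    unfold gdir
    rw [if_pos]
    · cases b <;> simp [sg]
    · intro j hj; simp [hj]
  have hgj : ∀ j, j ≠ i → gdir η (fun j => if j = i then !b else b) j = sg b := by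
    intro j hj
    unfold gdir
    rw [if_neg]
    · simp [hj]
    · intro hc
      obtain ⟨m, hm1, hm2⟩ := third hn i j
      exact hc m hm2 (by simp [hm1, hj])
  rw [← Finset.add_sum_erase _ _ (Finset.mem_univ i), hgi] at had
  have hr : ∑ j ∈ Finset.univ.erase i, a j * gdir η (fun j => if j = i then !b else b) j =
      - ∑ j ∈ Finset.univ.erase i, |a j| := by
    rw [← Finset.sum_neg_distrib]
    refine Finset.sum_congr rfl fun j hj => ?_
    rw [hgj j (Finset.ne_of_mem_erase hj), hA]
  rw [hr] at had
  have h3 := ha.2.2 _ (std_mem hB i)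
  rw [sum_std, ← Finset.add_sum_erase _ _ (Finset.mem_univ i)] at h3
  have h4 : ∑ j ∈ Finset.univ.erase i, |a j| * |x j| ≤ ∑ j ∈ Finset.univ.erase i, |a j| :=
    Finset.sum_le_sum fun j _ =>
      mul_le_of_le_one_right (abs_nonneg _) (abs_le_one_of_mem hB x hx j)
  have h5 : a i * -(η * sg b) = η * |a i| := by
    have := hA i
    linear_combination (-η) * this
  rw [h5] at had
  have h6 : 0 ≤ |a i| * (|x i| + η - 1) := by linarith
  have h7 : |a i| = 0 := by
    rcases (abs_nonneg (a i)).lt_or_eq with h | h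
    · nlinarith
    · exact h.symm
  rw [h7] at had
  apply ha.1
  have h8 : ∑ j ∈ Finset.univ.erase i, |a j| = 0 :=
    le_antisymm (by linarith) (Finset.sum_nonneg fun j _ => abs_nonneg _)
  rw [Finset.sum_eq_zero_iff_of_nonneg (fun j _ => abs_nonneg _)] at h8
  funext j
  by_cases hj : j = i
  · subst hj; exact abs_eq_zero.mp h7
  · exact abs_eq_zero.mp (h8 j (by simp [hj]))

theorem choose_all {n : ℕ} (hn : 3 ≤ n) {B : Set (Fin n → ℝ)} (hB : memU B)
    (hpar : ¬ IsParallelepiped B) (i₁ i₂ : Fin n)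
    (hne : i₁ ≠ i₂) (h1 : allOnes - stdB i₁ ∈ B) (h2 : allOnes - stdB i₂ ∈ B)
    (η : ℝ) (hη : 0 < η) (hη1 : η ≤ 1)
    (hfar : ∀ y ∈ B, ∃ i, y i < 1 - η)
    (x : Fin n → ℝ) (hx : x ∈ B) :
    ∃ σ : Fin n → Bool, (∃ i j, σ i ≠ σ j) ∧ Illuminates B (gdir η σ) x := by
  by_cases hx1 : x i₁ = 0
  · by_cases hx2 : x i₂ = 0
    · refine ⟨fun i => if i = i₁ then true else if i = i₂ then false else decide (x i < 0),
        ⟨i₁, i₂, by simp [hne.symm]⟩, illum_none hB i₁ i₂ hne h1 h2 x _ hx (gdir_ne hη _)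
        (gdir_abs_le hη hη1 _) (fun i hi => gdir_opp hη _ x i hi ?_) hx1 hx2⟩
      have e1 : i ≠ i₁ := by rintro rfl; exact hi hx1
      have e2 : i ≠ i₂ := by rintro rfl; exact hi hx2
      simp [e1, e2]
    · exact choose_one hn hB hpar i₁ i₂ hne h1 h2 η hη hη1 x hx hx1 hx2
  by_cases hx2 : x i₂ = 0
  · exact choose_one hn hB hpar i₂ i₁ hne.symm h2 h1 η hη hη1 x hx hx2 hx1
  -- both nonzero
  have main : ∀ σ : Fin n → Bool, (∀ i, x i ≠ 0 → σ i = decide (x i < 0)) →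
      Illuminates B (gdir η σ) x := by
    intro σ hσ
    obtain ⟨k, hk1, hk2⟩ := third hn i₁ i₂
    have hopp := fun i hi => gdir_opp hη σ x i hi (hσ i hi)
    by_cases e1 : σ k = σ i₁
    · exact illum_both hB i₁ i₂ hne h1 h2 x _ hx (gdir_ne hη _) (gdir_abs_le hη hη1 _) hopp hx1 hx2
        (gdir_abs_eq σ i₁ k hk1 e1)
    by_cases e2 : σ k = σ i₂
    · exact illum_both hB i₂ i₁ hne.symm h2 h1 x _ hx (gdir_ne hη _) (gdir_abs_le hη hη1 _) hopp
        hx2 hx1 (gdir_abs_eq σ i₂ k hk2 e2)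
    have e3 : σ i₂ = σ i₁ := by
      revert e1 e2
      cases σ k <;> cases σ i₁ <;> cases σ i₂ <;> simp
    exact illum_both hB i₁ i₂ hne h1 h2 x _ hx (gdir_ne hη _) (gdir_abs_le hη hη1 _) hopp hx1 hx2
        (gdir_abs_eq σ i₁ i₂ hne.symm e3)
  by_cases hz : ∃ k, x k = 0
  · obtain ⟨k, hk⟩ := hz
    have e : i₁ ≠ k := by rintro rfl; exact hx1 hk
    refine ⟨fun i => if i = k then !decide (x i₁ < 0) else decide (x i < 0),
      ⟨k, i₁, by simp [e]⟩, main _ fun i hi => ?_⟩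
    have : i ≠ k := by rintro rfl; exact hi hk
    simp [this]
  push Not at hz
  by_cases hc : ∃ i j, decide (x i < 0) ≠ decide (x j < 0)
  · exact ⟨fun i => decide (x i < 0), hc, main _ fun i _ => rfl⟩
  push Not at hc
  exact choose_const hn hB η hη hη1 hfar x hx hz (decide (x i₁ < 0)) fun i => hc i i₁

theorem exists_eta {n : ℕ} {B : Set (Fin n → ℝ)} (hB : memU B)
    (h : (allOnes : Fin n → ℝ) ∉ B) :
    ∃ η : ℝ, 0 < η ∧ η ≤ 1 ∧ ∀ y ∈ B, ∃ i, y i < 1 - η := by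
  have ho : Bᶜ ∈ nhds (allOnes : Fin n → ℝ) := hB.1.2.1.isClosed.isOpen_compl.mem_nhds h
  obtain ⟨r, hr, hball⟩ := Metric.mem_nhds_iff.mp ho
  refine ⟨min (r / 2) 1, by positivity, min_le_right _ _, fun y hy => ?_⟩
  by_contra! hc
  refine hball (?_ : y ∈ Metric.ball _ r) hy
  rw [Metric.mem_ball, dist_pi_lt_iff hr]
  intro i
  have e1 := hc i
  have e2 := (abs_le.mp (abs_le_one_of_mem hB y hy i)).2
  have e3 := min_le_left (r / 2) 1
  rw [Real.dist_eq, abs_lt]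
  simp only [allOnes]
  constructor <;> linarith

/-- If `B ∈ 𝒰^n`, `n ≥ 3`, is not a parallelepiped and contains
`𝟙 - e_i` for exactly the two distinct indices `i₁, i₂`, then `B` is illuminated
by a symmetric set of at most `2^n - 2` nonzero directions; in particular
`𝕀(B) ≤ 2^n - 2`. -/
theorem stmt14 (n : ℕ) (hn : 3 ≤ n) (B : Set (Fin n → ℝ)) (hB : memU B)
    (hpar : ¬ IsParallelepiped B) (i₁ i₂ : Fin n) (hne : i₁ ≠ i₂)
    (h1 : allOnes - stdB i₁ ∈ B) (h2 : allOnes - stdB i₂ ∈ B)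
    (hrest : ∀ j : Fin n, j ≠ i₁ → j ≠ i₂ → allOnes - stdB j ∉ B) :
    ∃ D : Finset (Fin n → ℝ), (∀ d ∈ D, d ≠ 0) ∧ (∀ d ∈ D, -d ∈ D) ∧
      D.card ≤ 2 ^ n - 2 ∧ IlluminatesSet B ↑D ∧
      illumNumber B ≤ 2 ^ n - 2 := by
  obtain ⟨k, hk1, hk2⟩ := third hn i₁ i₂
  obtain ⟨η, hη, hη1, hfar⟩ := exists_eta hB (ones_not_mem hB k (hrest k hk1 hk2))
  classical
  let S : Finset (Fin n → Bool) := Finset.univ \ {fun _ => true, fun _ => false}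
  have hS : ∀ σ : Fin n → Bool, σ ∈ S ↔ σ ≠ (fun _ => true) ∧ σ ≠ (fun _ => false) := by
    intro σ; simp [S]
  have hScard : S.card = 2 ^ n - 2 := by
    have hne' : (fun _ => true : Fin n → Bool) ≠ fun _ => false := by
      intro h; simpa using congrFun h i₁
    rw [Finset.card_sdiff_of_subset (Finset.subset_univ _), Finset.card_pair hne']
    simp
  have hcard : (S.image (gdir η)).card ≤ 2 ^ n - 2 := hScard ▸ Finset.card_image_le
  have hnz : ∀ d ∈ S.image (gdir η), d ≠ 0 := by
    intro d hd h0
    obtain ⟨σ, _, rfl⟩ := Finset.mem_image.mp hd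
    exact gdir_ne hη σ i₁ (congrFun h0 i₁)
  have hill : IlluminatesSet B ↑(S.image (gdir η)) := by
    intro x hx
    obtain ⟨σ, ⟨i, j, hij⟩, hI⟩ := choose_all hn hB hpar i₁ i₂ hne h1 h2 η hη hη1 hfar x
      (hB.1.2.1.isClosed.frontier_subset hx)
    refine ⟨_, Finset.mem_coe.mpr (Finset.mem_image_of_mem _ ((hS σ).mpr ⟨?_, ?_⟩)), hI⟩
    · rintro rfl; exact hij rfl
    · rintro rfl; exact hij rfl
  refine ⟨S.image (gdir η), hnz, ?_, hcard, hill, ?_⟩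
  · intro d hd
    obtain ⟨σ, hσ, rfl⟩ := Finset.mem_image.mp hd
    rw [← gdir_neg]
    rw [hS] at hσ
    refine Finset.mem_image_of_mem _ ((hS _).mpr ⟨fun h => hσ.2 ?_, fun h => hσ.1 ?_⟩)
    · funext i; simpa using congrFun h i
    · funext i; simpa using congrFun h i
  · refine le_trans (Nat.sInf_le ?_) hcard
    exact ⟨_, rfl, hnz, hill⟩
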